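/- Suppose there is τ > 0 such that every x ∈ 𝒟 with E_f(x) < τ satisfies: (a) x ∈ D; (b) ‖x − T(x)‖ ⪯ γ(E_f(x))·‖W_f(x)‖; (c) ‖W_f(T(x))‖ ⪯ β(E_f(x))·‖W_f(x)‖, where β is quasi-homogeneous of degree m ≥ 0 on [0,τ), γ is nondecreasing and positive on [0,τ), and ψ(t) = 1 − b·t·γ(t) is positive on [0,τ). Let x⁽⁰⁾ ∈ 𝒟 satisfy E_f(x⁽⁰⁾) < τ and φ(E_f(x⁽⁰⁾)) ≤ 1, where φ = β/ψ. Then the Picard iteration x⁽ᵏ⁺¹⁾ = T(x⁽ᵏ⁾) is well defined for all k ≥ 0, satisfies the coordinatewise bound ‖x⁽ᵏ⁾ − x⁽⁰⁾‖ ⪯ (γ(E_f(x⁽⁰⁾))/(1 − β(E_f(x⁽⁰⁾))))·‖W_f(x⁽⁰⁾)‖, and converges in Kⁿ to a root vector ξ of f. (Theorem 2.2 (i)) -/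

import Mathlib

open Finset Polynomial Filter

noncomputable section

/-- The Weierstrass correction `W_i(x) = f(x_i)/(C₀ ∏_{j≠i}(x_i − x_j))`. -/
def Wc {n : ℕ} {K : Type*} [NormedField K] (f : Polynomial K) (x : Fin n → K) (i : Fin n) : K :=
  eval (x i) f / (f.leadingCoeff * ∏ j ∈ univ.erase i, (x i - x j))

/-- `dmin x i = min_{j ≠ i} ‖x i - x j‖`. -/
def dmin {n : ℕ} {K : Type*} [NormedField K] (x : Fin n → K) (i : Fin n) : ℝ :=
  if h : (univ.erase i).Nonempty then (univ.erase i).inf' h fun j => ‖x i - x j‖ else 0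

/-- `E_f(x)` : the ℓ^p norm of the vector `(‖W_i(x)‖ / d_i(x))_i`. -/
def Ef {n : ℕ} {K : Type*} [NormedField K] (p : ENNReal) (f : Polynomial K)
    (x : Fin n → K) : ℝ :=
  ‖(WithLp.equiv p (Fin n → ℝ)).symm (fun i => ‖Wc f x i‖ / dmin x i)‖

/-- `σ_i(x) = Σ_{j≠i} W_j(x)/(x_i − x_j)`. -/
def sigmaf {n : ℕ} {K : Type*} [NormedField K] (f : Polynomial K) (x : Fin n → K)
    (i : Fin n) : K :=
  ∑ j ∈ univ.erase i, Wc f x j / (x i - x j)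

/-- The Ehrlich iteration function. -/
def PhiE {n : ℕ} {K : Type*} [NormedField K] (f : Polynomial K) (x : Fin n → K) : Fin n → K :=
  fun i => x i - Wc f x i / (1 + sigmaf f x i)

/-- The Prešić–Tanabe iteration function. -/
def TnbE {n : ℕ} {K : Type*} [NormedField K] (f : Polynomial K) (x : Fin n → K) : Fin n → K :=
  fun i => x i - Wc f x i * (1 - sigmaf f x i)

/-- `ξ` is a root vector of `f`, i.e. `f(z) = C₀ ∏ (z − ξᵢ)`. -/
def IsRootVector {n : ℕ} {K : Type*} [NormedField K] (f : Polynomial K) (ξ : Fin n → K) : Prop :=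
  f = C f.leadingCoeff * ∏ i, (X - C (ξ i))

/-- `E_f(x)` in the case `p = ∞`: the max of `‖W_i(x)‖ / d_i(x)`. -/
def Einf {n : ℕ} {K : Type*} [NormedField K] (f : Polynomial K) (x : Fin n → K) : ℝ :=
  if h : (univ : Finset (Fin n)).Nonempty then univ.sup' h fun i => ‖Wc f x i‖ / dmin x i else 0

lemma add_le_two_rpow_mul_lpNorm {n : ℕ} {p q : ENNReal} (hp : 1 ≤ p) (hpq : p⁻¹ + q⁻¹ = 1)
    (a : PiLp p (fun _ : Fin n => ℝ)) (ha : ∀ i, 0 ≤ a i) {i j : Fin n} (hij : i ≠ j) :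
    a i + a j ≤ (2 : ℝ) ^ (ENNReal.toReal q⁻¹) * ‖a‖ := by
  have : Fact (1 ≤ p) := ⟨hp⟩
  by_cases hpt : p = ⊤
  · subst hpt
    have hq : q⁻¹ = 1 := by simpa using hpq
    have hi := (le_abs_self _).trans (PiLp.norm_apply_le a i)
    have hj := (le_abs_self _).trans (PiLp.norm_apply_le a j)
    rw [hq]
    norm_num
    linarith
  have hr : 1 ≤ p.toReal := by
    simpa using (ENNReal.toReal_le_toReal ENNReal.one_ne_top hpt).2 hp
  set r := p.toReal with hr_def
  have hr0 : 0 < r := by linarith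
  have hp_inv : p⁻¹ ≠ ⊤ := ne_top_of_le_ne_top ENNReal.one_ne_top (hpq ▸ le_self_add)
  have hq_inv : q⁻¹ ≠ ⊤ := ne_top_of_le_ne_top ENNReal.one_ne_top (hpq ▸ le_add_self)
  have hq : ENNReal.toReal q⁻¹ = (r - 1) * (1 / r) := by
    have h := congrArg ENNReal.toReal hpq
    rw [ENNReal.toReal_add hp_inv hq_inv, ENNReal.toReal_inv, ENNReal.toReal_one, ← hr_def] at h
    field_simp at h ⊢
    linarith
  rw [hq, PiLp.norm_eq_sum hr0, Real.rpow_mul (by norm_num),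
    ← Real.mul_rpow (by positivity) (by positivity), one_div,
    Real.le_rpow_inv_iff_of_pos (add_nonneg (ha i) (ha j)) (by positivity) hr0]
  have h2 : a i ^ r + a j ^ r ≤ ∑ k, ‖a k‖ ^ r := by
    have h := Finset.sum_le_sum_of_subset_of_nonneg (f := fun k => ‖a k‖ ^ r)
      (Finset.subset_univ ({i, j} : Finset (Fin n))) (fun k _ _ => by positivity)
    rw [Finset.sum_pair hij] at h
    simpa [abs_of_nonneg (ha _)] using h
  have h1 : (a i + a j) ^ r ≤ 2 ^ (r - 1) * (a i ^ r + a j ^ r) := by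
    have h := NNReal.rpow_add_le_mul_rpow_add_rpow ⟨a i, ha i⟩ ⟨a j, ha j⟩ hr
    exact_mod_cast h
  exact h1.trans (mul_le_mul_of_nonneg_left h2 (by positivity))

lemma lpNorm_mono {n : ℕ} {p : ENNReal} (hp : 1 ≤ p) (a b : PiLp p (fun _ : Fin n => ℝ))
    (hab : ∀ i, |a i| ≤ |b i|) : ‖a‖ ≤ ‖b‖ := by
  have : Fact (1 ≤ p) := ⟨hp⟩
  by_cases hpt : p = ⊤
  · subst hpt
    rw [PiLp.norm_eq_ciSup a]
    exact Real.iSup_le (fun i => (hab i).trans (PiLp.norm_apply_le b i)) (norm_nonneg _)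
  have hr0 : 0 < p.toReal := ENNReal.toReal_pos (by positivity) hpt
  rw [PiLp.norm_eq_sum hr0, PiLp.norm_eq_sum hr0]
  gcongr with i
  exact hab i

section Weierstrass

variable {n : ℕ} {K : Type*} [NormedField K]

lemma erase_nonempty (hn : 2 ≤ n) (i : Fin n) : (univ.erase i).Nonempty := by
  rw [← Finset.card_pos, Finset.card_erase_of_mem (mem_univ i), Finset.card_univ, Fintype.card_fin]
  omega

lemma dmin_pos (hn : 2 ≤ n) {x : Fin n → K} (hx : Function.Injective x) (i : Fin n) :
    0 < dmin x i := by
  rw [dmin, dif_pos (erase_nonempty hn i), Finset.lt_inf'_iff]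
  intro j hj
  exact norm_pos_iff.2 (sub_ne_zero.2 fun h => (Finset.ne_of_mem_erase hj) (hx h).symm)

lemma dmin_le (x : Fin n → K) {i j : Fin n} (hij : i ≠ j) :
    dmin x i ≤ ‖x i - x j‖ := by
  have hj : j ∈ univ.erase i := Finset.mem_erase.2 ⟨hij.symm, mem_univ j⟩
  rw [dmin, dif_pos ⟨j, hj⟩]
  exact Finset.inf'_le _ hj

lemma le_dmin (hn : 2 ≤ n) {x : Fin n → K} {i : Fin n} {c : ℝ}
    (h : ∀ j, i ≠ j → c ≤ ‖x i - x j‖) : c ≤ dmin x i := by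
  rw [dmin, dif_pos (erase_nonempty hn i), Finset.le_inf'_iff]
  exact fun j hj => h j (Finset.ne_of_mem_erase hj).symm

lemma Ef_nonneg {p : ENNReal} (hp : 1 ≤ p) (f : K[X]) (x : Fin n → K) : 0 ≤ Ef p f x := by
  have : Fact (1 ≤ p) := ⟨hp⟩
  exact norm_nonneg (E := PiLp p (fun _ : Fin n => ℝ)) _

lemma Wc_eq_zero_of_Ef_eq_zero (hn : 2 ≤ n) {p : ENNReal} (hp : 1 ≤ p) {f : K[X]}
    {x : Fin n → K} (hx : Function.Injective x) (h : Ef p f x = 0) (i : Fin n) :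
    Wc f x i = 0 := by
  have : Fact (1 ≤ p) := ⟨hp⟩
  have hle := PiLp.norm_apply_le
    (show PiLp p (fun _ : Fin n => ℝ) from
      (WithLp.equiv p (Fin n → ℝ)).symm (fun i => ‖Wc f x i‖ / dmin x i)) i
  have h0 : ‖‖Wc f x i‖ / dmin x i‖ ≤ 0 := hle.trans_eq h
  have h1 := norm_le_zero_iff.1 h0
  rcases div_eq_zero_iff.1 h1 with h2 | h2
  · exact norm_eq_zero.1 h2
  · exact absurd h2 (dmin_pos hn hx i).ne'

lemma norm_sub_ge_of_correction {p q : ENNReal} (hn : 2 ≤ n) (hp : 1 ≤ p)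
    (hpq : p⁻¹ + q⁻¹ = 1) {f : K[X]} {x y : Fin n → K} (hx : Function.Injective x) {g : ℝ}
    (hg : 0 ≤ g) (hxy : ∀ i, ‖x i - y i‖ ≤ g * ‖Wc f x i‖) {i j : Fin n} (hij : i ≠ j) :
    (1 - (2 : ℝ) ^ (ENNReal.toReal q⁻¹) * Ef p f x * g) * ‖x i - x j‖ ≤ ‖y i - y j‖ := by
  have hpos : 0 < ‖x i - x j‖ := norm_pos_iff.2 (sub_ne_zero.2 fun h => hij (hx h))
  have hsum := add_le_two_rpow_mul_lpNorm hp hpq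
    (show PiLp p (fun _ : Fin n => ℝ) from
      (WithLp.equiv p (Fin n → ℝ)).symm (fun i => ‖Wc f x i‖ / dmin x i))
    (fun i => div_nonneg (norm_nonneg _) (dmin_pos hn hx i).le) hij
  change ‖Wc f x i‖ / dmin x i + ‖Wc f x j‖ / dmin x j ≤
    (2 : ℝ) ^ (ENNReal.toReal q⁻¹) * Ef p f x at hsum
  have hWi : ‖Wc f x i‖ ≤ ‖Wc f x i‖ / dmin x i * ‖x i - x j‖ := by
    rw [div_mul_eq_mul_div, le_div_iff₀ (dmin_pos hn hx i)]
    exact mul_le_mul_of_nonneg_left (dmin_le x hij) (norm_nonneg _)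
  have hWj : ‖Wc f x j‖ ≤ ‖Wc f x j‖ / dmin x j * ‖x i - x j‖ := by
    rw [div_mul_eq_mul_div, le_div_iff₀ (dmin_pos hn hx j), norm_sub_rev]
    exact mul_le_mul_of_nonneg_left (dmin_le x hij.symm) (norm_nonneg _)
  have hW : ‖Wc f x i‖ + ‖Wc f x j‖ ≤
      (2 : ℝ) ^ (ENNReal.toReal q⁻¹) * Ef p f x * ‖x i - x j‖ := by
    have := mul_le_mul_of_nonneg_right hsum hpos.le
    linarith
  have htri : ‖x i - x j‖ ≤ ‖x i - y i‖ + ‖y i - y j‖ + ‖x j - y j‖ := by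
    have h := norm_add₃_le (a := x i - y i) (b := y i - y j) (c := y j - x j)
    rw [norm_sub_rev (y j)] at h
    simpa using h
  have := mul_le_mul_of_nonneg_left hW hg
  linarith [hxy i, hxy j]

/-- One step of an iteration with correction factor `g` and Weierstrass contraction factor `β`
keeps the components distinct and does not increase `E_f`. -/
lemma injective_and_Ef_le_of_step {p q : ENNReal} (hn : 2 ≤ n) (hp : 1 ≤ p)
    (hpq : p⁻¹ + q⁻¹ = 1) {f : K[X]} {x y : Fin n → K} (hx : Function.Injective x) {g β : ℝ}
    (hg : 0 ≤ g) (hxy : ∀ i, ‖x i - y i‖ ≤ g * ‖Wc f x i‖)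
    (hW : ∀ i, ‖Wc f y i‖ ≤ β * ‖Wc f x i‖)
    (hψ : 0 < 1 - (2 : ℝ) ^ (ENNReal.toReal q⁻¹) * Ef p f x * g)
    (hβ : β ≤ 1 - (2 : ℝ) ^ (ENNReal.toReal q⁻¹) * Ef p f x * g) :
    Function.Injective y ∧ Ef p f y ≤ Ef p f x := by
  have hsub := fun {i j : Fin n} (hij : i ≠ j) =>
    norm_sub_ge_of_correction hn hp hpq hx hg hxy hij
  set ψ := 1 - (2 : ℝ) ^ (ENNReal.toReal q⁻¹) * Ef p f x * g
  have hy : Function.Injective y := by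
    intro i j h
    by_contra hij
    have hpos : 0 < ‖x i - x j‖ := norm_pos_iff.2 (sub_ne_zero.2 fun h => hij (hx h))
    have := hsub hij
    rw [h, sub_self, norm_zero] at this
    exact absurd (mul_pos hψ hpos) this.not_gt
  refine ⟨hy, lpNorm_mono hp _ _ fun i => ?_⟩
  change |‖Wc f y i‖ / dmin y i| ≤ |‖Wc f x i‖ / dmin x i|
  have hdx := dmin_pos hn hx i
  have hdy := dmin_pos hn hy i
  rw [abs_of_nonneg (by positivity), abs_of_nonneg (by positivity),
    div_le_div_iff₀ hdy hdx]
  have hd : ψ * dmin x i ≤ dmin y i := le_dmin hn fun j hij =>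
    (mul_le_mul_of_nonneg_left (dmin_le x hij) hψ.le).trans (hsub hij)
  calc ‖Wc f y i‖ * dmin x i ≤ (ψ * ‖Wc f x i‖) * dmin x i := by
        gcongr
        exact (hW i).trans (mul_le_mul_of_nonneg_right hβ (norm_nonneg _))
    _ = ‖Wc f x i‖ * (ψ * dmin x i) := by ring
    _ ≤ ‖Wc f x i‖ * dmin y i := by gcongr

/-- Lagrange interpolation in terms of the Weierstrass correction. -/
lemma eq_prod_add_sum_Wc (hn : 2 ≤ n) {f : K[X]} (hdeg : f.degree = (n : ℕ)) {x : Fin n → K}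
    (hx : Function.Injective x) :
    f = C f.leadingCoeff * (∏ i, (X - C (x i)) +
      ∑ i, C (Wc f x i) * ∏ j ∈ univ.erase i, (X - C (x j))) := by
  have hf0 : f ≠ 0 := by
    rintro rfl
    simp at hdeg
  have hlc : f.leadingCoeff ≠ 0 := leadingCoeff_ne_zero.2 hf0
  have hmonic : (∏ i, (X - C (x i))).Monic := monic_prod_of_monic _ _ fun i _ => monic_X_sub_C _
  have hdP : (∏ i, (X - C (x i))).degree = (n : WithBot ℕ) := by
    rw [degree_prod]
    simp
  have hd1 : (f - C f.leadingCoeff * ∏ i, (X - C (x i))).degree < (n : WithBot ℕ) := by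
    rw [← hdeg]
    refine degree_sub_lt_left ?_ hf0 ?_
    · rw [degree_C_mul hlc, hdP, hdeg]
    · rw [leadingCoeff_mul, leadingCoeff_C, hmonic.leadingCoeff, mul_one]
  have hd2 : (C f.leadingCoeff *
      ∑ i, C (Wc f x i) * ∏ j ∈ univ.erase i, (X - C (x j))).degree < (n : WithBot ℕ) := by
    rw [degree_C_mul hlc]
    refine (degree_sum_le _ _).trans_lt ((Finset.sup_lt_iff (WithBot.bot_lt_coe n)).2 ?_)
    intro i _
    rw [← smul_eq_C_mul]
    refine (degree_smul_le _ _).trans_lt ?_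
    rw [degree_prod]
    simp only [degree_X_sub_C, Finset.sum_const, Finset.card_erase_of_mem (mem_univ i),
      Finset.card_univ, Fintype.card_fin, nsmul_eq_mul, mul_one]
    exact WithBot.coe_lt_coe.2 (by omega : n - 1 < n)
  have key : f - C f.leadingCoeff * ∏ i, (X - C (x i)) = C f.leadingCoeff *
      ∑ i, C (Wc f x i) * ∏ j ∈ univ.erase i, (X - C (x j)) := by
    refine Polynomial.eq_of_degrees_lt_of_eval_index_eq (v := x) univ hx.injOn
      (by simpa using hd1) (by simpa using hd2) ?_
    intro i _
    have hprod : ∏ j ∈ univ.erase i, (x i - x j) ≠ 0 :=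
      Finset.prod_ne_zero_iff.2 fun j hj =>
        sub_ne_zero.2 fun h => (Finset.ne_of_mem_erase hj) (hx h).symm
    rw [eval_sub, eval_mul, eval_mul, eval_prod,
      Finset.prod_eq_zero (mem_univ i) (by simp), eval_finsetSum,
      Finset.sum_eq_single i]
    · simp only [eval_C, eval_mul, eval_prod, eval_sub, eval_X, Wc]
      field_simp
      simp
    · intro k _ hki
      rw [eval_mul, eval_prod, Finset.prod_eq_zero (Finset.mem_erase.2 ⟨hki.symm, mem_univ i⟩)
        (by simp), mul_zero]
    · simp
  rw [mul_add, ← key]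
  ring

lemma continuous_coeff_prod_X_sub_C {ι : Type*} (s : Finset ι) (m : ℕ) :
    Continuous fun x : ι → K => (∏ i ∈ s, (X - C (x i))).coeff m := by
  classical
  induction s using Finset.induction_on generalizing m with
  | empty => simpa using continuous_const
  | insert i s hi ih =>
    simp only [Finset.prod_insert hi, sub_mul, coeff_sub, coeff_C_mul]
    refine Continuous.sub ?_ ((continuous_apply i).mul (ih m))
    cases m with
    | zero => simpa using continuous_const
    | succ m => simpa only [coeff_X_mul] using ih m

/-- A limit of vectors with distinct components along which the Weierstrass correction tends to
zero is a root vector. -/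
lemma isRootVector_of_tendsto (hn : 2 ≤ n) {f : K[X]} (hdeg : f.degree = (n : ℕ))
    {u : ℕ → Fin n → K} (hu : ∀ k, Function.Injective (u k)) {ξ : Fin n → K}
    (hξ : Tendsto u atTop (nhds ξ))
    (hW : ∀ i, Tendsto (fun k => Wc f (u k) i) atTop (nhds 0)) : IsRootVector f ξ := by
  rw [IsRootVector]
  ext m
  have hlim : Tendsto (fun k => f.leadingCoeff * ((∏ i, (X - C (u k i))).coeff m +
      ∑ i, Wc f (u k) i * (∏ j ∈ univ.erase i, (X - C (u k j))).coeff m)) atTop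
      (nhds (f.leadingCoeff * ((∏ i, (X - C (ξ i))).coeff m +
        ∑ i, 0 * (∏ j ∈ univ.erase i, (X - C (ξ j))).coeff m))) := by
    refine (Tendsto.add ?_ (tendsto_finsetSum _ fun i _ => (hW i).mul ?_)).const_mul _
    · exact ((continuous_coeff_prod_X_sub_C univ m).tendsto ξ).comp hξ
    · exact ((continuous_coeff_prod_X_sub_C (univ.erase i) m).tendsto ξ).comp hξ
  have hconst : (fun k => f.leadingCoeff * ((∏ i, (X - C (u k i))).coeff m +
      ∑ i, Wc f (u k) i * (∏ j ∈ univ.erase i, (X - C (u k j))).coeff m)) =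
      fun _ => f.coeff m := by
    funext k
    conv_rhs => rw [eq_prod_add_sum_Wc hn hdeg (hu k)]
    simp only [coeff_C_mul, coeff_add, finsetSum_coeff]
  rw [hconst] at hlim
  simpa using tendsto_nhds_unique tendsto_const_nhds hlim

end Weierstrass

/-- Proinov, Theorem 2.2 (i). -/
theorem stmt_6 {n : ℕ} {K : Type*} [NormedField K] [CompleteSpace K] (hn : 2 ≤ n)
    (f : Polynomial K) (hdeg : f.degree = (n : ℕ))
    (p q : ENNReal) (hp : 1 ≤ p) (hpq : p⁻¹ + q⁻¹ = 1)
    (b : ℝ) (hb : b = (2 : ℝ) ^ (ENNReal.toReal q⁻¹))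
    (D : Set (Fin n → K)) (T : (Fin n → K) → Fin n → K)
    (τ : ℝ) (hτ : 0 < τ) (m : ℝ) (hm : 0 ≤ m)
    (β γ : ℝ → ℝ)
    (hβ0 : ∀ t, 0 ≤ t → t < τ → 0 ≤ β t)
    (hβmono : ∀ s t, 0 ≤ s → s ≤ t → t < τ → β s ≤ β t)
    (hβqh : ∀ l t, 0 ≤ l → l ≤ 1 → 0 ≤ t → t < τ → β (l * t) ≤ l ^ m * β t)
    (hγpos : ∀ t, 0 ≤ t → t < τ → 0 < γ t)
    (hγmono : ∀ s t, 0 ≤ s → s ≤ t → t < τ → γ s ≤ γ t)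
    (hψ : ∀ t, 0 ≤ t → t < τ → 0 < 1 - b * t * γ t)
    (habc : ∀ x : Fin n → K, Function.Injective x → Ef p f x < τ →
      x ∈ D ∧ (∀ i, ‖x i - T x i‖ ≤ γ (Ef p f x) * ‖Wc f x i‖) ∧
        (∀ i, ‖Wc f (T x) i‖ ≤ β (Ef p f x) * ‖Wc f x i‖))
    (x0 : Fin n → K) (hx0 : Function.Injective x0) (hE0 : Ef p f x0 < τ)
    (hφ : β (Ef p f x0) / (1 - b * Ef p f x0 * γ (Ef p f x0)) ≤ 1) :
    (∀ k : ℕ, T^[k] x0 ∈ D) ∧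
    (∀ k : ℕ, ∀ i, ‖T^[k] x0 i - x0 i‖ ≤
      γ (Ef p f x0) / (1 - β (Ef p f x0)) * ‖Wc f x0 i‖) ∧
    ∃ ξ : Fin n → K, IsRootVector f ξ ∧
      Tendsto (fun k => T^[k] x0) atTop (nhds ξ) := by
  subst hb
  set e := Ef p f x0 with he
  have he0 : 0 ≤ e := Ef_nonneg hp f x0
  have hβψ : β e ≤ 1 - (2 : ℝ) ^ (ENNReal.toReal q⁻¹) * e * γ e :=
    (div_le_one (hψ e he0 hE0)).1 hφ
  have hinv : ∀ k, Function.Injective (T^[k] x0) ∧ Ef p f (T^[k] x0) ≤ e := by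
    intro k
    induction k with
    | zero => exact ⟨hx0, le_rfl⟩
    | succ k ih =>
      obtain ⟨hinj, hle⟩ := ih
      rw [Function.iterate_succ_apply']
      set x := T^[k] x0
      have hx0' := Ef_nonneg hp f x
      have hlt := hle.trans_lt hE0
      obtain ⟨-, h1, h2⟩ := habc x hinj hlt
      have hmono : Ef p f x * γ (Ef p f x) ≤ e * γ e :=
        mul_le_mul hle (hγmono _ _ hx0' hle hE0) (hγpos _ hx0' hlt).le he0
      have hmono' := mul_le_mul_of_nonneg_left hmono
        (by positivity : (0 : ℝ) ≤ 2 ^ (ENNReal.toReal q⁻¹))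
      have hstep := injective_and_Ef_le_of_step hn hp hpq hinj (hγpos _ hx0' hlt).le h1 h2
        (hψ _ hx0' hlt) (by linarith [hβmono _ _ hx0' hle hE0])
      exact ⟨hstep.1, hstep.2.trans hle⟩
  have hstep : ∀ k, (∀ i, ‖T^[k] x0 i - T^[k + 1] x0 i‖ ≤ γ e * ‖Wc f (T^[k] x0) i‖) ∧
      ∀ i, ‖Wc f (T^[k + 1] x0) i‖ ≤ β e * ‖Wc f (T^[k] x0) i‖ := by
    intro k
    obtain ⟨hinj, hle⟩ := hinv k
    have hk0 := Ef_nonneg hp f (T^[k] x0)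
    obtain ⟨-, h1, h2⟩ := habc _ hinj (hle.trans_lt hE0)
    rw [Function.iterate_succ_apply']
    exact ⟨fun i => (h1 i).trans (mul_le_mul_of_nonneg_right (hγmono _ _ hk0 hle hE0)
        (norm_nonneg _)),
      fun i => (h2 i).trans (mul_le_mul_of_nonneg_right (hβmono _ _ hk0 hle hE0)
        (norm_nonneg _))⟩
  have hγ := hγpos e he0 hE0
  have hβ := hβ0 e he0 hE0
  have hWpow : ∀ k i, ‖Wc f (T^[k] x0) i‖ ≤ β e ^ k * ‖Wc f x0 i‖ := by
    intro k i
    induction k with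
    | zero => simp
    | succ k ih =>
      calc _ ≤ β e * ‖Wc f (T^[k] x0) i‖ := (hstep k).2 i
        _ ≤ β e * (β e ^ k * ‖Wc f x0 i‖) := by gcongr
        _ = _ := by ring
  obtain ⟨r, hr0, hr1, hWr, hr⟩ : ∃ r : ℝ, 0 ≤ r ∧ r < 1 ∧
      (∀ k i, ‖Wc f (T^[k] x0) i‖ ≤ r ^ k * ‖Wc f x0 i‖) ∧
      ∀ i, γ e / (1 - r) * ‖Wc f x0 i‖ ≤ γ e / (1 - β e) * ‖Wc f x0 i‖ := by
    rcases he0.eq_or_lt with h | h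
    · have hW0 := Wc_eq_zero_of_Ef_eq_zero hn hp hx0 h.symm
      refine ⟨0, le_rfl, one_pos, fun k i => ?_, fun i => by simp [hW0]⟩
      simpa [hW0] using hWpow k i
    · refine ⟨β e, hβ, hβψ.trans_lt ?_, hWpow, fun i => le_rfl⟩
      have : 0 < (2 : ℝ) ^ (ENNReal.toReal q⁻¹) * e * γ e := by positivity
      linarith
  have hdist : ∀ i k, dist (T^[k] x0 i) (T^[k + 1] x0 i) ≤ γ e * ‖Wc f x0 i‖ * r ^ k := by
    intro i k
    rw [dist_eq_norm]
    calc _ ≤ γ e * ‖Wc f (T^[k] x0) i‖ := (hstep k).1 i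
      _ ≤ γ e * (r ^ k * ‖Wc f x0 i‖) := by gcongr; exact hWr k i
      _ = _ := by ring
  refine ⟨fun k => (habc _ (hinv k).1 ((hinv k).2.trans_lt hE0)).1, fun k i => ?_, ?_⟩
  · refine le_trans ?_ (hr i)
    rw [← dist_eq_norm, dist_comm]
    calc dist (x0 i) (T^[k] x0 i) ≤ ∑ l ∈ range k, γ e * ‖Wc f x0 i‖ * r ^ l :=
          dist_le_range_sum_of_dist_le (f := fun k => T^[k] x0 i) k fun _ => hdist i _
      _ = γ e * ‖Wc f x0 i‖ * ∑ l ∈ range k, r ^ l := by rw [Finset.mul_sum]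
      _ ≤ γ e * ‖Wc f x0 i‖ * (1 - r)⁻¹ := by
          gcongr
          rw [← tsum_geometric_of_lt_one hr0 hr1]
          exact (summable_geometric_of_lt_one hr0 hr1).sum_le_tsum _ fun _ _ => by positivity
      _ = _ := by ring
  · choose ξ hξ using fun i => cauchySeq_tendsto_of_complete
      (cauchySeq_of_le_geometric r _ hr1 (hdist i))
    have hlim : Tendsto (fun k => T^[k] x0) atTop (nhds ξ) := tendsto_pi_nhds.2 hξ
    refine ⟨ξ, isRootVector_of_tendsto hn hdeg (fun k => (hinv k).1) hlim fun i => ?_, hlim⟩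
    refine squeeze_zero_norm (fun k => hWr k i) ?_
    simpa using (tendsto_pow_atTop_nhds_zero_of_lt_one hr0 hr1).mul_const ‖Wc f x0 i‖
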